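/- Commutation relations for the operators of b-deformed bipartite maps with vertices of degree at most three: for all integers i, j ≥ 1 and all 1 ≤ m, m' ≤ 3, the following hold (all sums over l ≥ 1 being locally finite): (a) [M⁽ᵐ⁾_i, M⁽ᵐ⁾_j] = Σ_{l≥1} D̃_{ij,l}(m) ∘ M⁽ᵐ⁾_l; (b) [M⁽ᵐ⁾_i, M⁽ᵐ'⁾_j] − [M⁽ᵐ⁾_j, M⁽ᵐ'⁾_i] = Σ_{l≥1} ( D̃_{ij,l}(m') ∘ M⁽ᵐ⁾_l + D̃_{ij,l}(m) ∘ M⁽ᵐ'⁾_l ); (c) [p_i^*, M⁽ᵐ⁾_j] − [p_j^*, M⁽ᵐ⁾_i] = Σ_{l≥1} D̃_{ij,l}(m) ∘ p_l^*. -/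

import Mathlib

noncomputable section

/-- The polynomial ring `K[p₁, p₂, …]`, with one variable `p_i` for each positive integer. -/
abbrev Rp (K : Type) [Field K] : Type := MvPolynomial ℕ+ K

/-- The partial derivative `∂/∂p_i` as a `K`-linear endomorphism (junk value `0` for `i = 0`). -/
def pderivN (K : Type) [Field K] (i : ℕ) : Module.End K (Rp K) :=
  if h : 0 < i then (MvPolynomial.pderiv (⟨i, h⟩ : ℕ+)).toLinearMap else 0

/-- Multiplication by the variable `p_i` (junk value `0` for `i = 0`). -/
def mulpN (K : Type) [Field K] (i : ℕ) : Module.End K (Rp K) :=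
  if h : 0 < i then LinearMap.mulLeft K (MvPolynomial.X (⟨i, h⟩ : ℕ+)) else 0

/-- The operator `p_i^* = i·∂/∂p_i`. -/
def pstar (K : Type) [Field K] (i : ℕ) : Module.End K (Rp K) :=
  (i : K) • pderivN K i

/-- The currents with `J₀ = 0`: `J_{−k}` is multiplication by `p_k` and
`J_k = (1+b)·k·∂/∂p_k` for `k ≥ 1`. -/
def Jop (K : Type) [Field K] (b : K) (m : ℤ) : Module.End K (Rp K) :=
  if 0 < m then ((1 + b) * (m : K)) • pderivN K m.toNat else mulpN K (-m).toNat

/-- The currents of the bipartite-map model: as `Jop`, except that `J₀ = u·id`. -/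
def JopU (K : Type) [Field K] (b u : K) (m : ℤ) : Module.End K (Rp K) :=
  if m = 0 then u • (1 : Module.End K (Rp K)) else Jop K b m

/-- The structure operators `D̃_{ij,l}(m)` of the trivalent bipartite map model, `1 ≤ m ≤ 3`:
`D̃_{ij,l}(1) = 0`, `D̃_{ij,l}(2) = (i−j)·δ_{l,i+j−2}·id` and
`D̃_{ij,l}(3) = (i−j)(2[l ≥ M−1] + [M−1 ≤ l ≤ i+j−3])·J_{i+j−3−l}
  + sgn(i−j)(2l−3μ+3)[μ−1 ≤ l ≤ M−2]·J_{i+j−3−l} + b(i−j)(i+j−3)·δ_{l,i+j−3}·id`,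
where `μ = min(i,j)`, `M = max(i,j)`. -/
def Dtcoef (K : Type) [Field K] (b u : K) (i j l : ℕ) : ℕ → Module.End K (Rp K)
  | 2 => if (l : ℤ) = (i : ℤ) + (j : ℤ) - 2 then
      ((i : K) - (j : K)) • (1 : Module.End K (Rp K)) else 0
  | 3 =>
      (((i : K) - (j : K)) *
          (2 * (if (max i j : ℤ) - 1 ≤ (l : ℤ) then (1 : K) else 0) +
            (if (max i j : ℤ) - 1 ≤ (l : ℤ) ∧ (l : ℤ) ≤ (i : ℤ) + (j : ℤ) - 3 then
              (1 : K) else 0)) +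
        ((((i : ℤ) - (j : ℤ)).sign : K) *
            ((2 * (l : ℤ) - 3 * (min i j : ℤ) + 3 : ℤ) : K)) *
          (if (min i j : ℤ) - 1 ≤ (l : ℤ) ∧ (l : ℤ) ≤ (max i j : ℤ) - 2 then (1 : K) else 0)) •
        JopU K b u ((i : ℤ) + (j : ℤ) - 3 - (l : ℤ)) +
      (b * ((i : K) - (j : K)) * ((i : K) + (j : K) - 3)) •
        (if (l : ℤ) = (i : ℤ) + (j : ℤ) - 3 then (1 : Module.End K (Rp K)) else 0)
  | _ => 0

section Currents
variable {K V : Type*} [Field K] [AddCommGroup V] [Module K V]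
  [TopologicalSpace V] [DiscreteTopology V]

/-- A family of currents `J` with central charge `α`, together with the operators `P` and `W`
obtained from it by applying the cut-and-join recursion once and twice; all sums are locally finite
and `P` and `W` are extended by zero to non-positive indices. -/
structure IsCurrentSystem (α b : K) (J P W : ℤ → Module.End K V) : Prop where
  comm : ∀ k l v, J k (J l v) = J l (J k v) + (if k + l = 0 then k else 0) • α • v
  eventually_zero : ∀ v, ∃ B, ∀ x ≥ B, J x v = 0
  P_nonpos : ∀ n ≤ 0, P n = 0
  hasSum_P : ∀ n ≥ 1, ∀ v, HasSum (fun c : ℤ => (if 0 ≤ c then (1 : ℤ) else 0) • J (n - 2 - c) (J c v))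
    (α • P n v - (n - 1) • b • J (n - 2) v)
  W_nonpos : ∀ n ≤ 0, W n = 0
  hasSum_W : ∀ i ≥ 1, ∀ v, HasSum (fun n => J (i - n - 1) (P n v)) (W i v - (i - 1) • b • P (i - 1) v)

lemma Module.End.hasSum_map {ι : Type*} (T : Module.End K V) {f : ι → V} {a : V} (h : HasSum f a) :
    HasSum (fun x => T (f x)) (T a) :=
  h.map T continuous_of_discreteTopology

lemma exists_hasSum_quad {J : ℤ → Module.End K V}
    (hJ : ∀ v, ∃ B, ∀ x ≥ B, J x v = 0) (s A : ℤ) (C : ℤ → ℤ) (hC : ∀ x < A, C x = 0) (v : V) :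
    ∃ a, HasSum (fun x => C x • J (s - x) (J x v)) a := by
  obtain ⟨B, hB⟩ := hJ v
  refine summable_of_hasFiniteSupport ((Set.finite_Ico A B).subset fun x hx => ?_)
  simp only [Function.mem_support] at hx
  refine ⟨?_, ?_⟩
  · by_contra h
    exact hx (by simp [hC x (by omega)])
  · by_contra h
    exact hx (by simp [hB x (by omega)])

lemma two_smul_of_hasSum_quad {α : K} {J : ℤ → Module.End K V}
    (comm : ∀ k l v, J k (J l v) = J l (J k v) + (if k + l = 0 then k else 0) • α • v)
    {s : ℤ} {C : ℤ → ℤ} {v a : V} (ha : HasSum (fun x => C x • J (s - x) (J x v)) a)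
    (hC : ∀ x, C x + C (s - x) = 0) {S : ℤ} (hS : s = 0 → HasSum (fun x => x * C x) S) :
    2 • a = -(if s = 0 then S else 0) • α • v := by
  have h2 := ((Equiv.subLeft s).hasSum_iff.2 ha)
  have h3 := ha.add h2
  rw [two_smul]
  refine h3.unique ?_
  have : ∀ x, C x • J (s - x) (J x v) + ((fun x => C x • J (s - x) (J x v)) ∘ (Equiv.subLeft s)) x
      = -(if s = 0 then x * C x else 0) • α • v := by
    intro x
    have hx := hC x
    simp only [Function.comp, Equiv.subLeft_apply, sub_sub_cancel]
    rw [comm (s - x) x, show C (s - x) = - C x by omega]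
    by_cases hs : s = 0
    · subst hs; simp; module
    · simp [hs]
  simp_rw [this]
  by_cases hs : s = 0
  · simp only [hs, if_true]
    exact ((hS hs).neg).map (zmultiplesHom V (α • v)) continuous_of_discreteTopology
  · simp [hs]

lemma hasSum_telescope {f F : ℤ → ℤ} (hf : ∀ x, F (x + 1) - F x = f x) {A B : ℤ} (hAB : A ≤ B) :
    HasSum (fun x => if A ≤ x ∧ x < B then f x else 0) (F B - F A) := by
  have key : ∀ C, A ≤ C → ∑ x ∈ Finset.Ico A C, (if A ≤ x ∧ x < B then f x else 0) =
      F (min C B) - F A := by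
    intro C hC
    induction C, hC using Int.leInduction with
    | base => simp [min_eq_left hAB]
    | succ C hC ih =>
      rw [← Finset.insert_Ico_right_eq_Ico_add_one hC, Finset.sum_insert (by simp), ih]
      by_cases hCB : C < B
      · rw [if_pos ⟨hC, hCB⟩, min_eq_left hCB.le, min_eq_left (by omega), ← hf]; ring
      · rw [if_neg (by omega), min_eq_right (by omega), min_eq_right (by omega), zero_add]
  have h := key B hAB
  rw [min_self] at h
  rw [← h]
  refine hasSum_sum_of_ne_finset_zero fun x hx => if_neg ?_
  simpa using hx

lemma hasSum_smul_of_discrete {ι : Type*} (c : K) {f : ι → V} {a : V} (h : HasSum f a) :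
    HasSum (fun x => c • f x) (c • a) :=
  Module.End.hasSum_map (c • (1 : Module.End K V)) h

lemma eq_zero_of_hasSum_quad [CharZero K] {α : K} {J : ℤ → Module.End K V}
    (comm : ∀ k l v, J k (J l v) = J l (J k v) + (if k + l = 0 then k else 0) • α • v)
    {s : ℤ} {C : ℤ → ℤ} {v a : V} (ha : HasSum (fun x => C x • J (s - x) (J x v)) a)
    (hC : ∀ x, C x + C (s - x) = 0) (hS : s = 0 → ∀ x, C x = 0) : a = 0 := by
  have h := two_smul_of_hasSum_quad comm ha hC (S := 0) (fun hs => by simp [hS hs])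
  have h2 : (2 : K) • a = 0 := by
    rw [two_smul, ← two_smul ℕ a, h]; simp
  simpa using h2

/-- `k • vertexCoeff k n` is the coefficient of `J (k + n - 2)` in `[J k, P n]`. -/
def vertexCoeff (k n : ℤ) : ℤ := (if 2 - n ≤ k then 1 else 0) + (if k ≤ 0 then 1 else 0)

namespace IsCurrentSystem

variable {α b : K} {J P W : ℤ → Module.End K V}

lemma exists_P_eq_zero (h : IsCurrentSystem α b J P W) (hα : α ≠ 0) (v : V) :
    ∃ B, ∀ n ≥ B, P n v = 0 := by
  obtain ⟨X, hX⟩ := h.eventually_zero v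
  choose Y hY using fun c => h.eventually_zero (J c v)
  obtain ⟨M, hM⟩ := ((Finset.Ico 0 X).image Y).exists_le
  refine ⟨max 1 (max (M + X + 2) (X + 2)), fun n hn => ?_⟩
  simp only [ge_iff_le, max_le_iff] at hn
  have hs := h.hasSum_P n hn.1 v
  have hz : ∀ c : ℤ, (if 0 ≤ c then (1 : ℤ) else 0) • J (n - 2 - c) (J c v) = 0 := by
    intro c
    by_cases hc : 0 ≤ c
    · by_cases hcX : c < X
      · have := hM (Y c) (Finset.mem_image_of_mem _ (Finset.mem_Ico.2 ⟨hc, hcX⟩))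
        rw [hY c _ (by omega), smul_zero]
      · rw [hX c (by omega), map_zero, smul_zero]
    · simp [hc]
  simp only [hz] at hs
  have := hs.unique hasSum_zero
  rw [hX (n - 2) (by omega)] at this
  simpa [hα] using this

lemma J_P (h : IsCurrentSystem α b J P W) (hα : α ≠ 0) (k : ℤ) {n : ℤ} (hn : 1 ≤ n) (v : V) :
    J k (P n v) = P n (J k v) + (k * vertexCoeff k n) • J (k + n - 2) v
      + (if k = 2 - n then (n - 1) * k else 0) • b • v := by
  have h1 := (Module.End.hasSum_map (J k) (h.hasSum_P n hn v)).sub (h.hasSum_P n hn (J k v))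
  have h2 : HasSum (fun c : ℤ =>
      (if c = k + n - 2 then (if 0 ≤ k + n - 2 then k else 0) • α • J (k + n - 2) v else 0)
      + (if c = - k then (if k ≤ 0 then k else 0) • α • J (k + n - 2) v else 0))
      ((if 0 ≤ k + n - 2 then k else 0) • α • J (k + n - 2) v
        + (if k ≤ 0 then k else 0) • α • J (k + n - 2) v) :=
    (hasSum_ite_eq _ _).add (hasSum_ite_eq _ _)
  have h3 := h1.unique (h2.congr_fun ?_)
  · have h4 := h.comm k (n - 2) v
    simp only [map_sub, map_zsmul, map_smul, h4] at h3
    refine smul_right_injective V hα ?_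
    have e1 : (k = 2 - n) ↔ (k + (n - 2) = 0) := by omega
    simp only [vertexCoeff, e1, show (2 - n ≤ k ↔ 0 ≤ k + n - 2) by omega]
    generalize (if k + (n - 2) = 0 then (1 : ℤ) else 0) = z
    split_ifs at h3 ⊢ <;> linear_combination (norm := module) h3
  · intro c
    simp only [map_zsmul, ← smul_sub]
    rw [h.comm k (n - 2 - c), h.comm k c, map_add, map_zsmul, map_smul]
    split_ifs <;> first
      | (exfalso; omega)
      | (try subst_vars
         try simp only [show n - 2 - (k + n - 2) = -k by ring, show n - 2 - -k = k + n - 2 by ring]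
         first
          | module
          | (rw [show k + n - 2 = -k by omega]; module))

lemma P_J (h : IsCurrentSystem α b J P W) (hα : α ≠ 0) (k : ℤ) {n : ℤ} (hn : 1 ≤ n) (v : V) :
    P n (J k v) = J k (P n v) - (k * vertexCoeff k n) • J (k + n - 2) v
      - (if k = 2 - n then (n - 1) * k else 0) • b • v := by
  rw [h.J_P hα k hn v]; abel

lemma virasoro_coeff_antisymm {n m : ℤ} (hn : 1 ≤ n) (hm : 1 ≤ m) (x : ℤ) :
    ((if 0 ≤ x then -((m - 2 - x) * vertexCoeff (m - 2 - x) n) else 0)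
        + (if 0 ≤ x - n + 2 then -((x - n + 2) * vertexCoeff (x - n + 2) n) else 0)
        - (n - m) * (if 0 ≤ x then 1 else 0))
      + ((if 0 ≤ n + m - 4 - x then
            -((m - 2 - (n + m - 4 - x)) * vertexCoeff (m - 2 - (n + m - 4 - x)) n) else 0)
        + (if 0 ≤ n + m - 4 - x - n + 2 then
            -((n + m - 4 - x - n + 2) * vertexCoeff (n + m - 4 - x - n + 2) n) else 0)
        - (n - m) * (if 0 ≤ n + m - 4 - x then 1 else 0)) = 0 := by
  unfold vertexCoeff
  split_ifs <;> omega

lemma virasoro_coeff_eq_zero {n m : ℤ} (hn : 1 ≤ n) (hm : 1 ≤ m) (hnm : n + m - 4 = 0) (x : ℤ) :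
    (if 0 ≤ x then -((m - 2 - x) * vertexCoeff (m - 2 - x) n) else 0)
        + (if 0 ≤ x - n + 2 then -((x - n + 2) * vertexCoeff (x - n + 2) n) else 0)
        - (n - m) * (if 0 ≤ x then 1 else 0) = 0 := by
  unfold vertexCoeff
  obtain ⟨rfl, rfl⟩ | ⟨rfl, rfl⟩ | ⟨rfl, rfl⟩ :
    n = 1 ∧ m = 3 ∨ n = 2 ∧ m = 2 ∨ n = 3 ∧ m = 1 := by omega
  all_goals split_ifs <;> omega

lemma P_P [CharZero K] (h : IsCurrentSystem α b J P W) (hα : α ≠ 0) {n m : ℤ} (hn : 1 ≤ n)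
    (hm : 1 ≤ m) (v : V) :
    P n (P m v) = P m (P n v) + (n - m) • P (n + m - 2) v := by
  by_cases hnm : n + m = 2
  · obtain ⟨rfl, rfl⟩ : n = 1 ∧ m = 1 := by omega
    simp
  have hd := (Module.End.hasSum_map (P n) (h.hasSum_P m hm v)).sub (h.hasSum_P m hm (P n v))
  obtain ⟨a₁, h1⟩ := exists_hasSum_quad h.eventually_zero (n + m - 4) 0
    (fun c => if 0 ≤ c then -((m - 2 - c) * vertexCoeff (m - 2 - c) n) else 0)
    (fun x hx => by simp [not_le.2 hx]) v
  obtain ⟨a₂, h2⟩ := exists_hasSum_quad h.eventually_zero (n + m - 4) (n - 2)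
    (fun x => if 0 ≤ x - n + 2 then -((x - n + 2) * vertexCoeff (x - n + 2) n) else 0)
    (fun x hx => if_neg (by omega)) v
  have h2' := (Equiv.addRight (n - 2)).hasSum_iff.2 h2
  have h3 := hasSum_ite_eq (n + m - 4) (((n - 1) * (n - 2)) • b • J (n + m - 4) v)
  have hval := hd.unique (((h1.add h2').add h3).congr_fun ?_)
  · have hquad := (h1.add h2).sub
      ((h.hasSum_P (n + m - 2) (by omega) v).map (zsmulAddGroupHom (n - m))
        continuous_of_discreteTopology)
    have h0 := eq_zero_of_hasSum_quad h.comm (s := n + m - 4) (v := v)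
      (C := fun x => (if 0 ≤ x then -((m - 2 - x) * vertexCoeff (m - 2 - x) n) else 0)
        + (if 0 ≤ x - n + 2 then -((x - n + 2) * vertexCoeff (x - n + 2) n) else 0)
        - (n - m) * (if 0 ≤ x then 1 else 0)) (hquad.congr_fun ?_) ?_ ?_
    · have hJ2 := h.P_J hα (m - 2) hn v
      rw [show m - 2 + n - 2 = n + m - 4 by ring] at hJ2
      simp only [map_sub, map_zsmul, map_smul, hJ2, zsmulAddGroupHom_apply,
        show n + m - 2 - 2 = n + m - 4 by ring] at hval h0
      refine smul_right_injective V hα ?_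
      have hdelta : (m - 1) * (if m - 2 = 2 - n then (n - 1) * (m - 2) else 0) = 0 := by
        split_ifs with hc
        · obtain ⟨rfl, rfl⟩ | ⟨rfl, rfl⟩ | ⟨rfl, rfl⟩ :
            n = 1 ∧ m = 3 ∨ n = 2 ∧ m = 2 ∨ n = 3 ∧ m = 1 := by omega
          all_goals rfl
        · ring
      have hv : (m - 1) * ((m - 2) * vertexCoeff (m - 2) n) = (m - 1) * (m - 2) := by
        unfold vertexCoeff
        rcases (by omega : m = 1 ∨ m = 2 ∨ 3 ≤ m) with rfl | rfl | hm3
        · simp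
        · simp
        · rw [if_pos (by omega), if_neg (by omega)]; ring
      have hv' := congrArg (fun z : ℤ => z • b • J (n + m - 4) v) hv
      have hdelta' := congrArg (fun z : ℤ => z • b • b • v) hdelta
      change α • _ = α • _
      linear_combination (norm := module) hval + h0 - hv' - hdelta'
    · intro x
      simp only [zsmulAddGroupHom_apply, Function.comp, show n + m - 2 - 2 = n + m - 4 by ring]
      module
    · exact virasoro_coeff_antisymm hn hm
    · exact virasoro_coeff_eq_zero hn hm
  · intro c
    simp only [map_zsmul, ← smul_sub]
    rw [h.P_J hα _ hn, h.P_J hα _ hn]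
    simp only [Function.comp, Equiv.coe_addRight, map_sub, map_zsmul, map_smul,
      show m - 2 - c + n - 2 = n + m - 4 - c by ring, show c + n - 2 - n + 2 = c by ring,
      show n + m - 4 - (c + n - 2) = m - 2 - c by ring, show c + (n - 2) = c + n - 2 by ring,
      show m - 2 - c = 2 - n ↔ c = n + m - 4 by omega]
    by_cases hc : 0 ≤ c
    · simp only [hc, if_true]
      by_cases hcn : c = n + m - 4
      · subst hcn
        simp only [sub_self, if_true, show m - 2 - (n + m - 4) = 2 - n by ring]
        by_cases hcm : n + m - 4 = 2 - n
        · rcases (by omega : n = 1 ∨ n = 2) with rfl | rfl <;> simp [hcm] <;> module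
        · simp only [hcm, if_false]
          module
      · simp only [hcn, if_false]
        by_cases hcm : c = 2 - n
        · rcases (by omega : n = 1 ∨ n = 2) with rfl | rfl <;> subst hcm <;> simp <;> module
        · simp only [hcm, if_false]
          module
    · have : (if c = n + m - 4 then ((n - 1) * (n - 2)) • b • J (n + m - 4) v else 0) = 0 := by
        split_ifs with hc'
        · rcases (by omega : n = 1 ∨ n = 2) with rfl | rfl <;> simp
        · rfl
      simp [hc, this]

lemma exists_hasSum_P (h : IsCurrentSystem α b J P W) (hα : α ≠ 0) (T : ℤ → Module.End K V)
    (v : V) : ∃ a, HasSum (fun n => T n (P n v)) a := by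
  obtain ⟨B, hB⟩ := h.exists_P_eq_zero hα v
  refine (summable_of_hasFiniteSupport ((Set.finite_Ico 1 B).subset fun n hn => ?_))
  simp only [Function.mem_support] at hn
  by_contra hn'
  simp only [Set.mem_Ico, not_and_or, not_le, not_lt] at hn'
  rcases hn' with hn' | hn'
  · exact hn (by simp [h.P_nonpos n (by omega)])
  · exact hn (by simp [hB n hn'])

/-- The coefficient of `J (i + m - 3 - N) ∘ P N` in `[W i, P m]`. -/
def wpCoeff (i m N : ℤ) : ℤ :=
  (if m - 1 ≤ N then N + 2 - 2 * m else 0)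
    + (i - N - 1) * ((if N ≤ i + m - 3 then 1 else 0) + (if i - 1 ≤ N then 1 else 0))

lemma hasSum_W_P [CharZero K] (h : IsCurrentSystem α b J P W) (hα : α ≠ 0) {i m : ℤ}
    (hi : 1 ≤ i) (hm : 1 ≤ m) (v : V) :
    HasSum (fun N => wpCoeff i m N • J (i + m - 3 - N) (P N v))
      (W i (P m v) - P m (W i v)
        - ((m - 1) * (2 - m) + (i - 1) * (i - 1 - m)) • b • P (i + m - 3) v) := by
  have hd := (h.hasSum_W i hi (P m v)).sub (Module.End.hasSum_map (P m) (h.hasSum_W i hi v))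
  obtain ⟨a, ha⟩ := h.exists_hasSum_P hα
    (fun n => ((i - n - 1) * vertexCoeff (i - n - 1) m) • J (i + m - 3 - n)) v
  have hD := hasSum_ite_eq (i + m - 3) (((m - 1) * (2 - m)) • b • P (i + m - 3) v)
  have hA : HasSum (fun n => (if 1 ≤ n then n - m else 0) • J (i - n - 1) (P (n + m - 2) v)) _ :=
    ((hd.sub ha).sub hD).congr_fun ?_
  · have hA' := ((Equiv.addRight (2 - m)).hasSum_iff.2 hA).add ha
    convert hA'.congr_fun ?_ using 1
    · have e1 : (i - 1) • b • P (i - 1) (P m v) = (i - 1) • b • P m (P (i - 1) v)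
          + ((i - 1) * (i - 1 - m)) • b • P (i + m - 3) v := by
        rcases (by omega : i = 1 ∨ 1 ≤ i - 1) with rfl | hi1
        · simp
        · rw [h.P_P hα hi1 hm, show i - 1 + m - 2 = i + m - 3 by ring]
          module
      simp only [map_sub, map_zsmul, map_smul]
      linear_combination (norm := module) e1
    · intro N
      simp only [Function.comp, Equiv.coe_addRight, show N + (2 - m) + m - 2 = N by ring,
        show i - (N + (2 - m)) - 1 = i + m - 3 - N by ring, LinearMap.smul_apply, ← add_smul]
      by_cases hN : N ≤ 0
      · simp [h.P_nonpos N hN]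
      congr 1
      simp only [wpCoeff, vertexCoeff, show 1 ≤ N + (2 - m) ↔ m - 1 ≤ N by omega,
        show 2 - m ≤ i - N - 1 ↔ N ≤ i + m - 3 by omega,
        show i - N - 1 ≤ 0 ↔ i - 1 ≤ N by omega, show N + (2 - m) - m = N + 2 - 2 * m by ring]
  · intro n
    simp only [LinearMap.smul_apply]
    by_cases hn : 1 ≤ n
    · rw [h.P_P hα hn hm, h.P_J hα _ hm]
      simp only [hn, if_true, map_add, map_zsmul, show i - n - 1 + m - 2 = i + m - 3 - n by ring]
      by_cases hnim : n = i + m - 3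
      · subst hnim
        simp only [show i - (i + m - 3) - 1 = 2 - m by ring, if_true]
        module
      · rw [if_neg (by omega), if_neg hnim]
        module
    · have hz : (if n = i + m - 3 then ((m - 1) * (2 - m)) • b • P (i + m - 3) v else 0) = 0 := by
        split_ifs with hnim
        · rw [← hnim]; simp [h.P_nonpos n (by omega)]
        · rfl
      rw [hz]
      simp [hn, h.P_nonpos n (by omega)]

lemma J_P_of_nonneg (h : IsCurrentSystem α b J P W) (hα : α ≠ 0) {k n : ℤ} (hk : 0 ≤ k)
    (hn : 1 ≤ n) (v : V) : J k (P n v) = P n (J k v) + k • J (k + n - 2) v := by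
  rw [h.J_P hα k hn]
  have e1 : k * vertexCoeff k n = k := by
    unfold vertexCoeff
    rcases (by omega : k = 0 ∨ 1 ≤ k) with rfl | hk
    · simp
    · rw [if_pos (by omega), if_neg (by omega)]; ring
  have e2 : (if k = 2 - n then (n - 1) * k else 0) = 0 := by
    split_ifs with hkn
    · rcases (by omega : k = 0 ∨ n = 1) with rfl | rfl <;> simp
    · rfl
  rw [e1, e2, zero_smul, add_zero]

lemma hasSum_J_W (h : IsCurrentSystem α b J P W) (hα : α ≠ 0) {k n : ℤ} (hk : 0 ≤ k)
    (hn : 1 ≤ n) (v : V) :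
    HasSum (fun x => (k * ((if 0 ≤ x then 1 else 0) + (if k - 1 ≤ x then 1 else 0)))
        • J (k + n - 3 - x) (J x v))
      (J k (W n v) - W n (J k v) - (k * (k + 2 * n - 3)) • b • J (k + n - 3) v) := by
  have hd := (Module.End.hasSum_map (J k) (h.hasSum_W n hn v)).sub (h.hasSum_W n hn (J k v))
  have hD := hasSum_ite_eq (k + n - 1) (k • α • P (k + n - 1) v)
  have hA : HasSum (fun a => (if 1 ≤ a then k else 0) • J (n - a - 1) (J (k + a - 2) v)) _ :=
    (hd.sub hD).congr_fun ?_
  · have hA' := (Equiv.addRight (2 - k)).hasSum_iff.2 hA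
    have hP : HasSum (fun x => (if 0 ≤ x then k else 0) • J (k + n - 3 - x) (J x v))
        (k • (α • P (k + n - 1) v - (k + n - 2) • b • J (k + n - 3) v)) := by
      rcases (by omega : k = 0 ∨ 1 ≤ k) with rfl | hk1
      · simp
      · have := (h.hasSum_P (k + n - 1) (by omega) v).map (zsmulAddGroupHom k)
          continuous_of_discreteTopology
        simp only [show k + n - 1 - 2 = k + n - 3 by ring,
          show k + n - 1 - 1 = k + n - 2 by ring] at this
        refine this.congr_fun fun x => ?_
        simp only [Function.comp, zsmulAddGroupHom_apply]
        split_ifs <;> module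
    convert (hA'.add hP).congr_fun ?_ using 1
    · have e1 : (n - 1) • b • J k (P (n - 1) v) = (n - 1) • b • P (n - 1) (J k v)
          + ((n - 1) * k) • b • J (k + n - 3) v := by
        rcases (by omega : n = 1 ∨ 1 ≤ n - 1) with rfl | hn1
        · simp
        · rw [h.J_P_of_nonneg hα hk hn1, show k + (n - 1) - 2 = k + n - 3 by ring]
          module
      simp only [map_sub, map_zsmul, map_smul]
      linear_combination (norm := module) e1
    · intro x
      simp only [Function.comp, Equiv.coe_addRight, show k + (x + (2 - k)) - 2 = x by ring,
        show n - (x + (2 - k)) - 1 = k + n - 3 - x by ring, ← add_smul]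
      congr 1
      split_ifs <;> omega
  · intro a
    rw [h.comm k (n - a - 1)]
    by_cases ha : 1 ≤ a
    · rw [h.J_P_of_nonneg hα hk ha]
      simp only [ha, if_true, map_add, map_zsmul]
      by_cases hak : a = k + n - 1
      · subst hak
        simp only [show k + (n - (k + n - 1) - 1) = 0 by ring, if_true]
        module
      · rw [if_neg (by omega), if_neg hak]
        module
    · have hz : (if a = k + n - 1 then k • α • P (k + n - 1) v else 0) = 0 := by
        split_ifs with hak
        · rw [← hak]; simp [h.P_nonpos a (by omega)]
        · rfl
      rw [hz]
      simp [ha, h.P_nonpos a (by omega)]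

/-- The coefficient of `J (i + j - 3 - l) ∘ W l` in `[W i, W j]`, for `j < i`. -/
def dCoeff (i j l : ℤ) : ℤ :=
  if i - 1 ≤ l then (if l ≤ i + j - 3 then 3 * (i - j) else 2 * (i - j))
  else if j - 1 ≤ l then 2 * l - 3 * j + 3 else 0

lemma jwCoeff_antisymm {i j ε : ℤ} (hj : 1 ≤ j) (hij : j < i) (hε : ε = -1 ∨ ε = 0) (x : ℤ) :
    ((i + ε) * ((if 0 ≤ x then 1 else 0) + (if i + ε - 1 ≤ x then 1 else 0))
      - (j + ε) * ((if 0 ≤ x then 1 else 0) + (if j + ε - 1 ≤ x then 1 else 0))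
      - (if 1 ≤ x - ε then dCoeff i j (x - ε) else 0))
    + ((i + ε) * ((if 0 ≤ i + j - 3 + ε - x then 1 else 0)
        + (if i + ε - 1 ≤ i + j - 3 + ε - x then 1 else 0))
      - (j + ε) * ((if 0 ≤ i + j - 3 + ε - x then 1 else 0)
        + (if j + ε - 1 ≤ i + j - 3 + ε - x then 1 else 0))
      - (if 1 ≤ i + j - 3 + ε - x - ε then dCoeff i j (i + j - 3 + ε - x - ε) else 0)) = 0 := by
  unfold dCoeff
  rcases hε with rfl | rfl <;> grind

lemma jwCoeff_eq_zero {i j ε : ℤ} (hj : 1 ≤ j) (hij : j < i) (hε : ε = -1 ∨ ε = 0)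
    (hs : i + j - 3 + ε = 0) (x : ℤ) :
    (i + ε) * ((if 0 ≤ x then 1 else 0) + (if i + ε - 1 ≤ x then 1 else 0))
      - (j + ε) * ((if 0 ≤ x then 1 else 0) + (if j + ε - 1 ≤ x then 1 else 0))
      - (if 1 ≤ x - ε then dCoeff i j (x - ε) else 0) = 0 := by
  unfold dCoeff
  rcases hε with rfl | rfl
  · obtain ⟨rfl, rfl⟩ : i = 3 ∧ j = 1 := by omega
    split_ifs <;> omega
  · obtain ⟨rfl, rfl⟩ : i = 2 ∧ j = 1 := by omega
    split_ifs <;> omega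

lemma hasSum_J_W_sub [CharZero K] (h : IsCurrentSystem α b J P W) (hα : α ≠ 0) {i j ε : ℤ}
    (hj : 1 ≤ j) (hij : j < i) (hε : ε = -1 ∨ ε = 0) (v : V) :
    HasSum (fun l => (if 1 ≤ l then dCoeff i j l else 0) • J (i + j - 3 - l) (J (l + ε) v))
      ((J (i + ε) (W j v) - W j (J (i + ε) v)) - (J (j + ε) (W i v) - W i (J (j + ε) v))
        - ((i - j) * (i + j - 3)) • b • J (i + j - 3 + ε) v) := by
  obtain ⟨a, ha⟩ := exists_hasSum_quad h.eventually_zero (i + j - 3 + ε) 0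
    (fun x => if 1 ≤ x - ε then dCoeff i j (x - ε) else 0) (fun x hx => if_neg (by omega)) v
  have hl := (h.hasSum_J_W hα (show 0 ≤ i + ε by omega) hj v).sub
    (h.hasSum_J_W hα (show 0 ≤ j + ε by omega) (show 1 ≤ i by omega) v)
  have h0 := eq_zero_of_hasSum_quad h.comm (s := i + j - 3 + ε) (v := v)
    ((hl.sub ha).congr_fun fun x => ?_) (jwCoeff_antisymm hj hij hε)
    (jwCoeff_eq_zero hj hij hε)
  · convert ((Equiv.addRight ε).hasSum_iff.2 ha).congr_fun ?_ using 1
    · simp only [show i + ε + j - 3 = i + j - 3 + ε by ring,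
        show j + ε + i - 3 = i + j - 3 + ε by ring] at h0
      linear_combination (norm := module) h0
    · intro l
      simp only [Function.comp, Equiv.coe_addRight, add_sub_cancel_right,
        show i + j - 3 + ε - (l + ε) = i + j - 3 - l by ring]
  · simp only [show i + ε + j - 3 = i + j - 3 + ε by ring,
        show j + ε + i - 3 = i + j - 3 + ε by ring]
    module

lemma wpCoeff_sub {i j N : ℤ} (hj : 1 ≤ j) (hij : j < i) (hN : 1 ≤ N) :
    wpCoeff i j N - wpCoeff j i N = dCoeff i j N + (i - j) := by
  unfold dCoeff wpCoeff
  split_ifs <;> omega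

lemma hasSum_W_P_sub [CharZero K] (h : IsCurrentSystem α b J P W) (hα : α ≠ 0) {i j : ℤ}
    (hj : 1 ≤ j) (hij : j < i) (v : V) :
    HasSum (fun l => (if 1 ≤ l then dCoeff i j l else 0) • J (i + j - 3 - l) (P l v))
      ((W i (P j v) - P j (W i v)) - (W j (P i v) - P i (W j v)) - (i - j) • W (i + j - 2) v
        - ((i - j) * (i + j - 3)) • b • P (i + j - 3) v) := by
  have h1 := ((h.hasSum_W_P hα (show 1 ≤ i by omega) hj v).sub
    (h.hasSum_W_P hα hj (show 1 ≤ i by omega) v)).sub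
    ((h.hasSum_W (i + j - 2) (by omega) v).map (zsmulAddGroupHom (i - j))
      continuous_of_discreteTopology)
  convert h1.congr_fun ?_ using 1
  · simp only [zsmulAddGroupHom_apply, show i + j - 2 - 1 = i + j - 3 by ring,
      show j + i - 3 = i + j - 3 by ring]
    module
  · intro l
    simp only [Function.comp, zsmulAddGroupHom_apply, show i + j - 2 - l - 1 = i + j - 3 - l by ring,
      show j + i - 3 = i + j - 3 by ring, ← sub_smul]
    split_ifs with hl
    · rw [wpCoeff_sub hj hij hl, add_sub_cancel_right]
    · simp [h.P_nonpos l (by omega)]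

lemma exists_hasSum_regroup (h : IsCurrentSystem α b J P W) (hα : α ≠ 0) {q r : ℤ}
    {D : ℤ → ℤ → ℤ} (hD : ∀ m ≤ 0, ∀ N, D m N = 0) {g : ℤ → V} {v : V}
    (hg : ∀ m, HasSum (fun N => D m N • J (m + r - N) (P N v)) (g m)) :
    ∃ y T, HasSum (fun m => J (q - m) (g m)) T ∧
      (∀ N, HasSum (fun x => D (x + N - r) N • J (q + r - N - x) (J x (P N v))) (y N)) ∧
      HasSum y T := by
  obtain ⟨B, hB⟩ := h.exists_P_eq_zero hα v
  choose X hX using fun N => h.eventually_zero (P N v)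
  obtain ⟨Y, hY⟩ := ((Finset.Ico 1 B).image X).exists_le
  let F : ℤ × ℤ → V := fun p => D p.1 p.2 • J (q - p.1) (J (p.1 + r - p.2) (P p.2 v))
  have hF : Summable F := by
    refine summable_of_hasFiniteSupport
      (((Set.finite_Ioo 0 (Y + B - r)).prod (Set.finite_Ico 1 B)).subset ?_)
    rintro ⟨m, N⟩ hmN
    simp only [Function.mem_support, F] at hmN
    have hm : 0 < m := by
      by_contra hm
      exact hmN (by simp [hD m (by omega)])
    have hN : 1 ≤ N := by
      by_contra hN
      exact hmN (by simp [h.P_nonpos N (by omega)])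
    have hNB : N < B := by
      by_contra hN
      exact hmN (by simp [hB N (by omega)])
    have hXY := hY _ (Finset.mem_image_of_mem X (Finset.mem_Ico.2 ⟨hN, hNB⟩))
    refine ⟨⟨hm, ?_⟩, hN, hNB⟩
    by_contra hmY
    exact hmN (by simp [hX N (m + r - N) (by simp only at hmY; omega)])
  obtain ⟨T, hT⟩ := hF
  have hsum : ∀ N, Summable (fun x => D (x + N - r) N • J (q + r - N - x) (J x (P N v))) := by
    intro N
    obtain ⟨y, hy⟩ := exists_hasSum_quad h.eventually_zero (q + r - N) (1 - N + r)
      (fun x => D (x + N - r) N) (fun x hx => hD _ (by omega) _) (P N v)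
    exact hy.summable
  choose y hy using hsum
  refine ⟨y, T, hT.prod_fiberwise fun m => ?_, hy, ?_⟩
  · refine (Module.End.hasSum_map (J (q - m)) (hg m)).congr_fun fun N => ?_
    simp [F]
  · refine ((Equiv.prodComm ℤ ℤ).hasSum_iff.2 hT).prod_fiberwise fun N => ?_
    refine ((Equiv.addRight (r - N)).hasSum_iff.2 (hy N)).congr_fun fun m => ?_
    simp only [Function.comp, Equiv.coe_addRight, Equiv.prodComm_apply, Prod.swap, F]
    congr 2 <;> ring_nf

lemma hasSum_W_J (h : IsCurrentSystem α b J P W) (hα : α ≠ 0) {i : ℤ} (hi : 1 ≤ i) (k : ℤ) (v : V) :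
    HasSum (fun x => (if k - 1 ≤ x then
        -(k * ((if 0 ≤ x then 1 else 0) + (if k ≤ 0 then 1 else 0))) else 0) •
          J (i + k - 3 - x) (J x v))
      (W i (J k v) - J k (W i v) + k • α • P (i + k - 1) v
        + ((if k ≤ 1 then (1 - k) * k else 0) + (i - 1) * (k * vertexCoeff k (i - 1))) •
          b • J (i + k - 3) v
        + (if k = 3 - i then (i - 1) * (i - 2) * (3 - i) else 0) • b • b • v) := by
  have hd := (h.hasSum_W i hi (J k v)).sub (Module.End.hasSum_map (J k) (h.hasSum_W i hi v))
  have h1 := hasSum_ite_eq (i + k - 1) (k • α • P (i + k - 1) v)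
  have h2 := hasSum_ite_eq (2 - k) ((if k ≤ 1 then (1 - k) * k else 0) • b • J (i + k - 3) v)
  have hA : HasSum (fun n => (if 1 ≤ n then -(k * vertexCoeff k n) else 0) •
      J (i - n - 1) (J (k + n - 2) v)) _ := ((hd.add h1).add h2).congr_fun ?_
  · convert ((Equiv.addRight (2 - k)).hasSum_iff.2 hA).congr_fun ?_ using 1
    · have e1 : (i - 1) • b • P (i - 1) (J k v) = (i - 1) • b • J k (P (i - 1) v)
          - ((i - 1) * (k * vertexCoeff k (i - 1))) • b • J (i + k - 3) v
          - (if k = 3 - i then (i - 1) * (i - 2) * (3 - i) else 0) • b • b • v := by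
        rcases (by omega : i = 1 ∨ 1 ≤ i - 1) with rfl | hi1
        · simp
        · rw [h.P_J hα k hi1, show k + (i - 1) - 2 = i + k - 3 by ring]
          by_cases hk : k = 3 - i
          · subst hk
            rw [if_pos (by ring), if_pos rfl]
            module
          · rw [if_neg (by omega), if_neg hk]
            module
      simp only [map_sub, map_zsmul, map_smul]
      linear_combination (norm := module) e1
    · intro x
      simp only [Function.comp, Equiv.coe_addRight, show k + (x + (2 - k)) - 2 = x by ring,
        show i - (x + (2 - k)) - 1 = i + k - 3 - x by ring, vertexCoeff,
        show 1 ≤ x + (2 - k) ↔ k - 1 ≤ x by omega,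
        show 2 - (x + (2 - k)) ≤ k ↔ 0 ≤ x by omega]
  · intro n
    by_cases hn : 1 ≤ n
    · rw [h.P_J hα k hn, h.comm k (i - n - 1)]
      simp only [hn, if_true, map_sub, map_zsmul, map_smul]
      have e1 : (if k + (i - n - 1) = 0 then k else 0) • α • P n v
          = if n = i + k - 1 then k • α • P (i + k - 1) v else 0 := by
        by_cases hnk : n = i + k - 1
        · rw [if_pos (by omega), if_pos hnk, hnk]
        · rw [if_neg (by omega), if_neg hnk, zero_smul]
      have e2 : (if k = 2 - n then (n - 1) * k else 0) • b • J (i - n - 1) v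
          = if n = 2 - k then
              (if k ≤ 1 then (1 - k) * k else 0) • b • J (i + k - 3) v else 0 := by
        by_cases hnk : n = 2 - k
        · subst hnk
          rw [if_pos (by omega), if_pos rfl, if_pos (by omega)]
          ring_nf
        · rw [if_neg (by omega), if_neg hnk, zero_smul]
      linear_combination (norm := module) e1 + e2
    · have hz : (if n = i + k - 1 then k • α • P (i + k - 1) v else 0) = 0 := by
        split_ifs with hnk
        · rw [← hnk]; simp [h.P_nonpos n (by omega)]
        · rfl
      have hz' : (if n = 2 - k then
          (if k ≤ 1 then (1 - k) * k else 0) • b • J (i + k - 3) v else 0) = 0 := by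
        split_ifs with hnk
        · omega
        · simp
        · rfl
      rw [hz, hz']
      simp [hn, h.P_nonpos n (by omega)]

/-- The portion of `N + 1 - j` which is expanded into currents in the computation of
`[W i, W j]`; the remaining portion is antisymmetric under `N ↦ i + j - 2 - N`. -/
def wCoeff (i j N : ℤ) : ℤ := if N < j - 1 then i - j else if N < i - 1 then i - N - 1 else 0

/-- The coefficient of `J (i + j - 4 - N - x) ∘ J x ∘ P N` in the computation of `[W i, W j]`. -/
def wwCoeff (i j N x : ℤ) : ℤ :=
  (if j - N - 1 - 1 ≤ x then
      -((j - N - 1) * ((if 0 ≤ x then 1 else 0) + (if j - N - 1 ≤ 0 then 1 else 0))) else 0)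
    + (if 1 ≤ x + N - (i - 3) then wpCoeff i (x + N - (i - 3)) N else 0)
    + (if 0 ≤ x then wCoeff i j N else 0)
    - (if 1 ≤ x + N - -1 then dCoeff i j (x + N - -1) else 0)

lemma wwCoeff_antisymm {i j N : ℤ} (hj : 1 ≤ j) (hij : j < i) (hN : 1 ≤ N) (x : ℤ) :
    wwCoeff i j N x + wwCoeff i j N (i + j - 4 - N - x) = 0 := by
  unfold wwCoeff wpCoeff wCoeff dCoeff
  grind

lemma wwCoeff_eq_of_add_eq {i j N x : ℤ} (hj : 1 ≤ j) (hij : j < i) (hN : 1 ≤ N)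
    (hNij : N = i + j - 4) (hx : x ≠ 0) :
    wwCoeff i j N x = (if 1 ≤ x ∧ x < i - 1 then i - j - 2 * x else 0)
      + (if 2 - i ≤ x ∧ x < 0 then -(i - j) - 2 * x else 0) := by
  subst hNij
  unfold wwCoeff wpCoeff wCoeff dCoeff
  grind

lemma wwCoeff_linear {i j N : ℤ} (hj : 1 ≤ j) (hij : j < i) (hN : 1 ≤ N) :
    -((if j - N - 1 ≤ 1 then (1 - (j - N - 1)) * (j - N - 1) else 0)
        + (i - 1) * ((j - N - 1) * vertexCoeff (j - N - 1) (i - 1)))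
      + (if N < i + j - 2 then wCoeff i j N * (i + j - 2 - N - 1) else 0)
      + (if 1 ≤ N + 3 - i then (N + 3 - i - 1) * (2 - (N + 3 - i))
          + (i - 1) * (i - 1 - (N + 3 - i)) else 0)
      + (j - 1) * wpCoeff i (j - 1) N - dCoeff i j (N + 1) * N - (i - j) * (i + j - 3) = 0 := by
  unfold wpCoeff wCoeff dCoeff vertexCoeff
  rcases (by omega : N ≤ j - 3 ∨ j = N + 2 ∨ j = N + 1 ∨ j ≤ N) with h1 | h1 | h1 | h1
  all_goals rcases (by omega : N ≤ i - 3 ∨ i = N + 2 ∨ i = N + 1 ∨ i ≤ N) with h2 | h2 | h2 | h2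
  all_goals rcases (by omega : N ≤ i + j - 4 ∨ i = N + 3 - j ∨ i + j - 2 ≤ N) with h3 | h3 | h3
  all_goals try omega
  all_goals repeat first | rw [if_pos (by omega)] | rw [if_neg (by omega)]
  all_goals first | ring1 | (subst_vars; ring1)

lemma wCoeff_antisymm {i j : ℤ} (hij : j < i) (N : ℤ) :
    (N + 1 - j - wCoeff i j N)
      + (i + j - 2 - N + 1 - j - wCoeff i j (i + j - 2 - N)) = 0 := by
  unfold wCoeff
  grind

lemma hasSum_mul_wwCoeff {i j S : ℤ} (hj : 1 ≤ j) (hij : j < i) (hN : 1 ≤ i + j - 4)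
    (hS : HasSum (fun x => x * wwCoeff i j (i + j - 4) x) S) :
    6 * S = 2 * (i - 1) * (i - 2) * (3 * (i - j) - 2 * (2 * i - 3)) := by
  have h1 := hasSum_telescope (f := fun x => 6 * (x * (i - j - 2 * x)))
    (F := fun x => 3 * (i - j) * (x ^ 2 - x) - 2 * (2 * x ^ 3 - 3 * x ^ 2 + x))
    (fun x => by ring) (show 1 ≤ i - 1 by omega)
  have h2 := hasSum_telescope (f := fun x => 6 * (x * (-(i - j) - 2 * x)))
    (F := fun x => -3 * (i - j) * (x ^ 2 - x) - 2 * (2 * x ^ 3 - 3 * x ^ 2 + x))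
    (fun x => by ring) (show 2 - i ≤ 0 by omega)
  have h3 := (hS.mul_left 6).unique ((h1.add h2).congr_fun fun x => ?_)
  · linear_combination h3
  · by_cases hx : x = 0
    · simp [hx]
    · rw [wwCoeff_eq_of_add_eq hj hij hN rfl hx]
      split_ifs <;> ring

lemma hasSum_mul_sub_wCoeff {i j S : ℤ} (hj : 1 ≤ j) (hij : j < i)
    (hS : HasSum (fun n => if 1 ≤ n ∧ n < i + j - 2 then
      (n + 1 - j - wCoeff i j n) * (i + j - 2 - 2 * n) else 0) S) :
    6 * S = 2 * (i - 1) * (i - 2) * (3 * (i - j) - 2 * (2 * i - 3)) := by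
  have h1 := hasSum_telescope (f := fun n => 6 * ((n + 1 - i) * (i + j - 2 - 2 * n)))
    (F := fun x => -2 * (2 * x ^ 3 - 3 * x ^ 2 + x) + 3 * (i + j - 4 + 2 * i) * (x ^ 2 - x)
      + 6 * (1 - i) * (i + j - 2) * x) (fun x => by ring) hj
  have h2 := hasSum_telescope (f := fun n => 6 * ((2 * n + 2 - i - j) * (i + j - 2 - 2 * n)))
    (F := fun x => -4 * (2 * x ^ 3 - 3 * x ^ 2 + x) + 12 * (i + j - 2) * (x ^ 2 - x)
      - 6 * (i + j - 2) ^ 2 * x) (fun x => by ring) (show j ≤ i - 1 by omega)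
  have h3 := hasSum_telescope (f := fun n => 6 * ((n + 1 - j) * (i + j - 2 - 2 * n)))
    (F := fun x => -2 * (2 * x ^ 3 - 3 * x ^ 2 + x) + 3 * (i + j - 4 + 2 * j) * (x ^ 2 - x)
      + 6 * (1 - j) * (i + j - 2) * x) (fun x => by ring) (show i - 1 ≤ i + j - 2 by omega)
  have h4 := (hS.mul_left 6).unique (((h1.add h2).add h3).congr_fun fun n => ?_)
  · linear_combination h4
  · have hw : 1 ≤ n → n < i + j - 2 → n + 1 - j - wCoeff i j n
        = (if 1 ≤ n ∧ n < j then n + 1 - i else 0)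
          + (if j ≤ n ∧ n < i - 1 then 2 * n + 2 - i - j else 0)
          + (if i - 1 ≤ n ∧ n < i + j - 2 then n + 1 - j else 0) := by
      unfold wCoeff
      grind
    by_cases hn : 1 ≤ n ∧ n < i + j - 2
    · rw [if_pos hn, hw hn.1 hn.2]
      split_ifs <;> ring
    · rw [if_neg hn, if_neg (by omega), if_neg (by omega), if_neg (by omega)]
      simp

lemma two_smul_of_hasSum_P_P [CharZero K] (h : IsCurrentSystem α b J P W) (hα : α ≠ 0) {t S : ℤ}
    {f : ℤ → ℤ} (hf : ∀ n, f n + f (t - n) = 0) {v z : V}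
    (hz : HasSum (fun n => f n • P (t - n) (P n v)) z)
    (hS : HasSum (fun n => if 1 ≤ n ∧ n < t then f n * (t - 2 * n) else 0) S) :
    2 • z = S • P (t - 2) v := by
  rw [two_smul]
  refine (hz.add ((Equiv.subLeft t).hasSum_iff.2 hz)).unique
    ((hS.map (zmultiplesHom V (P (t - 2) v)) continuous_of_discreteTopology).congr_fun fun n => ?_)
  simp only [Function.comp, Equiv.subLeft_apply, sub_sub_cancel, zmultiplesHom_apply,
    show f (t - n) = -f n by linarith [hf n]]
  by_cases hn : 1 ≤ n
  · by_cases hnt : n < t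
    · rw [h.P_P hα (show 1 ≤ t - n by omega) hn, if_pos ⟨hn, hnt⟩,
        show t - n + n - 2 = t - 2 by ring]
      module
    · simp [h.P_nonpos (t - n) (by omega), hnt]
  · simp [h.P_nonpos n (by omega), hn]

lemma hasSum_W_W [CharZero K] (h : IsCurrentSystem α b J P W) (hα : α ≠ 0) {i j : ℤ}
    (hj : 1 ≤ j) (hij : j < i) (v : V) :
    HasSum (fun l => (if 1 ≤ l then dCoeff i j l else 0) • J (i + j - 3 - l) (W l v))
      (W i (W j v) - W j (W i v) - ((i - j) * (i + j - 3)) • b • W (i + j - 3) v) := by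
  have hi : 1 ≤ i := by omega
  -- the two nested expansions, summed by columns
  obtain ⟨y₂, T₂, hT₂, hy₂, hs₂⟩ := h.exists_hasSum_regroup hα (q := j - 1) (r := i - 3)
    (D := fun m N => if 1 ≤ m then wpCoeff i m N else 0) (fun m hm N => if_neg (by omega))
    (v := v) (g := fun m => if 1 ≤ m then W i (P m v) - P m (W i v)
        - ((m - 1) * (2 - m) + (i - 1) * (i - 1 - m)) • b • P (i + m - 3) v else 0) fun m => by
      split_ifs with hm
      · refine (h.hasSum_W_P hα hi hm v).congr_fun fun N => ?_
        rw [show m + (i - 3) - N = i + m - 3 - N by ring]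
      · simp
  obtain ⟨y₃, T₃, hT₃, hy₃, hs₃⟩ := h.exists_hasSum_regroup hα (q := i + j - 3) (r := -1)
    (D := fun l _ => if 1 ≤ l then dCoeff i j l else 0) (fun m hm N => if_neg (by omega))
    (v := v) (g := fun l => (if 1 ≤ l then dCoeff i j l else 0) •
      (W l v - (l - 1) • b • P (l - 1) v)) fun l => by
      by_cases hl : 1 ≤ l
      · refine ((h.hasSum_W l hl v).map (zsmulAddGroupHom (if 1 ≤ l then dCoeff i j l else 0))
          continuous_of_discreteTopology).congr_fun fun N => ?_
        simp [show l + -1 - N = l - N - 1 by ring]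
      · simp [hl]
  -- terms of the form `J (i + j - 4 - N) ∘ P N`
  have hlin : ∀ f : ℤ → ℤ, ∃ B, HasSum (fun N => f N • J (i + j - 4 - N) (P N v)) B := fun f =>
    h.exists_hasSum_P hα (fun N => f N • J (i + j - 4 - N)) v
  obtain ⟨B₁, hB₁⟩ := hlin fun N =>
    -((if j - N - 1 ≤ 1 then (1 - (j - N - 1)) * (j - N - 1) else 0)
        + (i - 1) * ((j - N - 1) * vertexCoeff (j - N - 1) (i - 1)))
      + (if N < i + j - 2 then wCoeff i j N * (i + j - 2 - N - 1) else 0)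
  obtain ⟨B₂, hB₂⟩ := hlin fun N => if 1 ≤ N + 3 - i then
    (N + 3 - i - 1) * (2 - (N + 3 - i)) + (i - 1) * (i - 1 - (N + 3 - i)) else 0
  obtain ⟨B₃, hB₃⟩ := hlin fun N => if 0 ≤ N then dCoeff i j (N + 1) * N else 0
  have hB₄ : HasSum (fun N => ((j - 1) * wpCoeff i (j - 1) N) • J (i + j - 4 - N) (P N v))
      ((j - 1) • (W i (P (j - 1) v) - P (j - 1) (W i v)
        - ((j - 2) * (3 - j) + (i - 1) * (i - j)) • b • P (i + j - 4) v)) := by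
    rcases (by omega : j = 1 ∨ 1 ≤ j - 1) with rfl | hj1
    · simp
    · convert ((h.hasSum_W_P hα hi hj1 v).map (zsmulAddGroupHom (j - 1))
        continuous_of_discreteTopology).congr_fun fun N => ?_ using 1
      · simp only [zsmulAddGroupHom_apply, show i + (j - 1) - 3 = i + j - 4 by ring]
        module
      · simp only [Function.comp, zsmulAddGroupHom_apply, mul_smul,
          show i + (j - 1) - 3 = i + j - 4 by ring]
  have hB₅ : HasSum (fun N => ((i - j) * (i + j - 3)) • J (i + j - 4 - N) (P N v))
      (((i - j) * (i + j - 3)) • (W (i + j - 3) v - (i + j - 4) • b • P (i + j - 4) v)) := by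
    rcases (by omega : i + j - 3 = 0 ∨ 1 ≤ i + j - 3) with hij3 | hij3
    · simp [hij3]
    · convert ((h.hasSum_W (i + j - 3) hij3 v).map
        (zsmulAddGroupHom ((i - j) * (i + j - 3))) continuous_of_discreteTopology).congr_fun
        fun N => ?_ using 1
      · simp only [zsmulAddGroupHom_apply, show i + j - 3 - 1 = i + j - 4 by ring]
      · simp only [Function.comp, zsmulAddGroupHom_apply,
          show i + j - 3 - N - 1 = i + j - 4 - N by ring]
  have hB : B₁ + B₂ + (j - 1) • (W i (P (j - 1) v) - P (j - 1) (W i v)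
        - ((j - 2) * (3 - j) + (i - 1) * (i - j)) • b • P (i + j - 4) v) - B₃
      - ((i - j) * (i + j - 3)) • (W (i + j - 3) v - (i + j - 4) • b • P (i + j - 4) v) = 0 := by
    refine ((((hB₁.add hB₂).add hB₄).sub hB₃).sub hB₅).unique
      ((hasSum_zero (α := V)).congr_fun fun N => ?_)
    by_cases hN : 1 ≤ N
    · simp only [← add_smul, ← sub_smul]
      rw [if_pos (show 0 ≤ N by omega), wwCoeff_linear hj hij hN, zero_smul]
    · simp [h.P_nonpos N (by omega)]
  -- the commutators `[W i, P m]`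
  have hWP : HasSum (fun m => J (j - m - 1) (W i (P m v) - P m (W i v))) (T₂ + b • B₂) := by
    have hB₂' := (Equiv.addRight (i - 3)).hasSum_iff.2 (hasSum_smul_of_discrete b hB₂)
    refine (hT₂.add hB₂').congr_fun fun m => ?_
    simp only [Function.comp, Equiv.coe_addRight, show m + (i - 3) = i + m - 3 by ring,
      show i + m - 3 + 3 - i = m by ring, show i + j - 4 - (i + m - 3) = j - m - 1 by ring,
      show j - 1 - m = j - m - 1 by ring]
    split_ifs with hm
    · simp only [map_sub, map_zsmul, map_smul]
      module
    · simp [h.P_nonpos m (by omega)]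
  -- the right-hand side
  have hR : HasSum (fun l => (if 1 ≤ l then dCoeff i j l else 0) • J (i + j - 3 - l) (W l v))
      (T₃ + b • B₃) := by
    have hB₃' := (Equiv.subRight 1).hasSum_iff.2 (hasSum_smul_of_discrete b hB₃)
    refine (hT₃.add hB₃').congr_fun fun l => ?_
    simp only [Function.comp, Equiv.subRight_apply, show i + j - 4 - (l - 1) = i + j - 3 - l by ring,
      sub_add_cancel, show 0 ≤ l - 1 ↔ 1 ≤ l by omega]
    split_ifs with hl
    · simp only [map_sub, map_zsmul, map_smul]
      module
    · simp
  -- the quadratic terms in `P`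
  obtain ⟨Z, hZ⟩ := h.exists_hasSum_P hα
    (fun N => (N + 1 - j - wCoeff i j N) • P (i + j - 2 - N)) v
  have hWJ : HasSum (fun N => W i (J (j - N - 1) (P N v)) - J (j - N - 1) (W i (P N v)))
      (W i (W j v - (j - 1) • b • P (j - 1) v)
        - (W j (W i v) - (j - 1) • b • P (j - 1) (W i v)) - (T₂ + b • B₂)) := by
    refine (((Module.End.hasSum_map (W i) (h.hasSum_W j hj v)).sub
      (h.hasSum_W j hj (W i v))).sub hWP).congr_fun fun N => ?_
    rw [map_sub]
    abel
  have hδ := hasSum_ite_eq (i + j - 4) (((i - 1) * (i - 2) * (3 - i)) • b • b • P (i + j - 4) v)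
  have hY := ((((hWJ.sub (hasSum_smul_of_discrete α hZ)).sub (hasSum_smul_of_discrete b hB₁)).add hδ).add hs₂).sub hs₃
  obtain ⟨S, hS⟩ : Summable (fun n => if 1 ≤ n ∧ n < i + j - 2 then
      (n + 1 - j - wCoeff i j n) * (i + j - 2 - 2 * n) else 0) :=
    summable_of_hasFiniteSupport ((Set.finite_Ico 1 (i + j - 2)).subset fun n hn => by
      by_contra hn'
      exact hn (if_neg hn'))
  have h2Z := h.two_smul_of_hasSum_P_P hα (wCoeff_antisymm hij) hZ hS
  have h2Y := ((hasSum_smul_of_discrete (2 : K) hY).unique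
    ((hasSum_ite_eq (i + j - 4) (-S • α • P (i + j - 4) v)).congr_fun fun N => ?_))
  · have hb := congrArg (b • ·) hB
    simp only [smul_zero] at hb
    convert hR using 1
    refine smul_right_injective V (two_ne_zero : (2 : K) ≠ 0) ?_
    change (2 : K) • _ = (2 : K) • _
    rw [show i + j - 2 - 2 = i + j - 4 by ring] at h2Z
    simp only [map_sub, map_zsmul, map_smul] at h2Y hb
    linear_combination (norm := module) h2Y + α • h2Z + (2 : K) • hb
  · by_cases hN : 1 ≤ N
    · have hy₄ : HasSum (fun x => (if 0 ≤ x then wCoeff i j N else 0) •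
          J (i + j - 4 - N - x) (J x (P N v)))
          (wCoeff i j N • α • P (i + j - 2 - N) (P N v)
            - (if N < i + j - 2 then wCoeff i j N * (i + j - 2 - N - 1) else 0) •
              b • J (i + j - 4 - N) (P N v)) := by
        by_cases hNt : N < i + j - 2
        · convert ((h.hasSum_P (i + j - 2 - N) (by omega) (P N v)).map
            (zsmulAddGroupHom (wCoeff i j N)) continuous_of_discreteTopology).congr_fun
            fun x => ?_ using 1
          · simp only [zsmulAddGroupHom_apply, hNt, if_true,
              show i + j - 2 - N - 2 = i + j - 4 - N by ring]
            module
          · simp only [Function.comp, zsmulAddGroupHom_apply,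
              show i + j - 2 - N - 2 = i + j - 4 - N by ring]
            split_ifs <;> module
        · have hw : wCoeff i j N = 0 := by
            rw [wCoeff, if_neg (by omega), if_neg (by omega)]
          simp [hw]
      have hquad := (((h.hasSum_W_J hα hi (j - N - 1) (P N v)).add (hy₂ N)).add hy₄).sub (hy₃ N)
      have hval := two_smul_of_hasSum_quad h.comm (s := i + j - 4 - N) (C := wwCoeff i j N)
        (v := P N v) (S := S) (hquad.congr_fun fun x => ?_) (wwCoeff_antisymm hj hij hN) ?_
      · have hδ' : (if j - N - 1 = 3 - i then (i - 1) * (i - 2) * (3 - i) else 0) •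
            b • b • P N v = if N = i + j - 4 then
              ((i - 1) * (i - 2) * (3 - i)) • b • b • P (i + j - 4) v else 0 := by
          by_cases hNij : N = i + j - 4
          · rw [if_pos (by omega), if_pos hNij, hNij]
          · rw [if_neg (by omega), if_neg hNij, zero_smul]
        have hS' : (if i + j - 4 - N = 0 then S else 0) • α • P N v
            = -if N = i + j - 4 then -S • α • P (i + j - 4) v else 0 := by
          by_cases hNij : N = i + j - 4
          · rw [if_pos (by omega), if_pos hNij, hNij, neg_smul, neg_neg]
          · rw [if_neg (by omega), if_neg hNij, zero_smul, neg_zero]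
        rw [show i + (j - N - 1) - 1 = i + j - 2 - N by ring,
          show i + (j - N - 1) - 3 = i + j - 4 - N by ring] at hval
        simp only [LinearMap.smul_apply]
        linear_combination (norm := module) hval - (2 : K) • hδ' - hS'
      · simp only [wwCoeff, show j - 1 + (i - 3) - N - x = i + j - 4 - N - x by ring,
          show i + j - 3 + -1 - N - x = i + j - 4 - N - x by ring,
          show i + (j - N - 1) - 3 - x = i + j - 4 - N - x by ring]
        module
      · intro hs
        obtain rfl : N = i + j - 4 := by omega
        obtain ⟨S', hS'⟩ : Summable (fun x => x * wwCoeff i j (i + j - 4) x) := by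
          refine summable_of_hasFiniteSupport ((Set.finite_Ioo (1 - i) i).subset fun x hx => ?_)
          by_contra hx'
          simp only [Set.mem_Ioo, not_and_or, not_lt] at hx'
          refine hx ?_
          beta_reduce
          rw [wwCoeff_eq_of_add_eq hj hij hN rfl (by omega), if_neg (by omega), if_neg (by omega)]
          simp
        have e1 := hasSum_mul_wwCoeff hj hij hN hS'
        have e2 := hasSum_mul_sub_wCoeff hj hij hS
        rwa [show S = S' by omega]
    · have hyz : ∀ {f : ℤ → ℤ} {s : ℤ} {y : V},
          HasSum (fun x => f x • J (s - x) (J x (P N v))) y → y = 0 := fun hy =>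
        hy.unique (hasSum_zero.congr_fun fun x => by simp [h.P_nonpos N (by omega)])
      rw [hyz (hy₂ N), hyz (hy₃ N)]
      by_cases hNij : N = i + j - 4
      · simp [← hNij, h.P_nonpos N (by omega)]
      · simp [hNij, h.P_nonpos N (by omega)]

end IsCurrentSystem

end Currents

lemma hasSum_of_eq {ι V : Type*} [AddCommMonoid V] [TopologicalSpace V] {f : ι → V} {a a' : V}
    (h : HasSum f a) (e : a = a') : HasSum f a' :=
  e ▸ h

lemma hasSum_indicator_iff_finsum_mem {ι V : Type*} [AddCommGroup V] [TopologicalSpace V]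
    [DiscreteTopology V] {s : Set ι} {f : ι → V} {a : V} :
    HasSum (s.indicator f) a ↔ (s ∩ Function.support f).Finite ∧ a = ∑ᶠ x ∈ s, f x := by
  rw [finsum_mem_def, ← Set.support_indicator]
  have htsum : (Function.support (s.indicator f)).Finite →
      ∑' x, s.indicator f x = ∑ᶠ x, s.indicator f x := fun h => tsum_eq_finsum h
  constructor
  · intro h
    have hfin : (Function.support (s.indicator f)).Finite := by
      have h0 := h.summable.tendsto_cofinite_zero
      rw [nhds_discrete, Filter.tendsto_pure] at h0
      exact h0
    exact ⟨hfin, by rw [← htsum hfin, h.tsum_eq]⟩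
  · rintro ⟨hfin, rfl⟩
    rw [← htsum hfin]
    exact (summable_of_hasFiniteSupport hfin).hasSum

lemma hasSum_indicator_Ici_one_iff {V : Type*} [AddCommGroup V] [TopologicalSpace V]
    {g : ℤ → V} {a : V} :
    HasSum ((Set.Ici (1 : ℕ)).indicator fun l => g l) a
      ↔ HasSum (fun l : ℤ => if 1 ≤ l then g l else 0) a := by
  rw [← (Nat.cast_injective (R := ℤ)).hasSum_iff]
  · refine iff_of_eq (congrArg (HasSum · a) ?_)
    ext l
    simp [Set.indicator_apply]
  · intro l hl
    refine if_neg fun h => hl ⟨l.toNat, ?_⟩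
    omega

section Polynomials

variable {K : Type} [Field K]

open IsCurrentSystem (dCoeff)

lemma MvPolynomial.pderiv_comm {σ : Type*} (i j : σ) (f : MvPolynomial σ K) :
    pderiv i (pderiv j f) = pderiv j (pderiv i f) := by
  classical
  have h : ⁅pderiv (R := K) i, pderiv (R := K) j⁆ = 0 := by
    refine derivation_ext fun k => ?_
    rw [Derivation.commutator_apply, pderiv_X, pderiv_X]
    simp only [Pi.single_apply]
    split_ifs <;> simp
  have h' := DFunLike.congr_fun h f
  rwa [Derivation.commutator_apply, Derivation.zero_apply, sub_eq_zero] at h'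

lemma pderivN_coe (n : ℕ+) (f : Rp K) : pderivN K n f = MvPolynomial.pderiv n f :=
  LinearMap.congr_fun (dif_pos n.pos : pderivN K n = _) f

lemma mulpN_coe (n : ℕ+) (f : Rp K) : mulpN K n f = MvPolynomial.X n * f :=
  LinearMap.congr_fun (dif_pos n.pos : mulpN K n = _) f

lemma pderivN_comm {i j : ℕ} (hi : 0 < i) (hj : 0 < j) (f : Rp K) :
    pderivN K i (pderivN K j f) = pderivN K j (pderivN K i f) := by
  lift i to ℕ+ using hi
  lift j to ℕ+ using hj
  simp only [pderivN_coe, MvPolynomial.pderiv_comm i]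

lemma mulpN_comm {i j : ℕ} (hi : 0 < i) (hj : 0 < j) (f : Rp K) :
    mulpN K i (mulpN K j f) = mulpN K j (mulpN K i f) := by
  lift i to ℕ+ using hi
  lift j to ℕ+ using hj
  simp only [mulpN_coe, mul_left_comm]

lemma pderivN_mulpN {i j : ℕ} (hi : 0 < i) (hj : 0 < j) (f : Rp K) :
    pderivN K i (mulpN K j f) = mulpN K j (pderivN K i f) + if i = j then f else 0 := by
  classical
  lift i to ℕ+ using hi
  lift j to ℕ+ using hj
  simp only [pderivN_coe, mulpN_coe, MvPolynomial.pderiv_mul, MvPolynomial.pderiv_X,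
    Pi.single_apply, PNat.coe_inj, @eq_comm _ j]
  split_ifs <;> simp [add_comm]

lemma exists_pderivN_eq_zero (f : Rp K) : ∃ B, ∀ i ≥ B, pderivN K i f = 0 := by
  obtain ⟨B, hB⟩ := (f.vars.image fun k : ℕ+ => (k : ℕ)).bddAbove
  refine ⟨B + 1, fun i hi => ?_⟩
  lift i to ℕ+ using by omega
  rw [pderivN_coe]
  refine MvPolynomial.pderiv_eq_zero_of_notMem_vars fun h => ?_
  have := hB (Finset.mem_image_of_mem _ h)
  omega

lemma JopU_of_pos (b u : K) {k : ℤ} (hk : 0 < k) :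
    JopU K b u k = ((1 + b) * (k : K)) • pderivN K k.toNat := by
  rw [JopU, if_neg hk.ne', Jop, if_pos hk]

lemma JopU_of_neg (b u : K) {k : ℤ} (hk : k < 0) : JopU K b u k = mulpN K (-k).toNat := by
  rw [JopU, if_neg hk.ne, Jop, if_neg hk.not_gt]

lemma JopU_zero (b u : K) : JopU K b u 0 = u • 1 := if_pos rfl

lemma JopU_comm (b u : K) (k l : ℤ) (f : Rp K) :
    JopU K b u k (JopU K b u l f)
      = JopU K b u l (JopU K b u k f) + (if k + l = 0 then k else 0) • (1 + b) • f := by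
  rcases lt_trichotomy k 0 with hk | rfl | hk
  · rcases lt_trichotomy l 0 with hl | rfl | hl
    · rw [JopU_of_neg b u hk, JopU_of_neg b u hl, mulpN_comm (by omega) (by omega), if_neg (by omega)]
      simp
    · simp [JopU_zero, hk.ne]
    · rw [JopU_of_neg b u hk, JopU_of_pos b u hl]
      simp only [map_smul, LinearMap.smul_apply, pderivN_mulpN (show 0 < l.toNat by omega)
        (show 0 < (-k).toNat by omega),
        show l.toNat = (-k).toNat ↔ k + l = 0 by omega]
      split_ifs with h
      · obtain rfl : k = -l := by omega
        module
      · simp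
  · simp [JopU_zero]
  · rcases lt_trichotomy l 0 with hl | rfl | hl
    · rw [JopU_of_neg b u hl, JopU_of_pos b u hk]
      simp only [map_smul, LinearMap.smul_apply, pderivN_mulpN (show 0 < k.toNat by omega)
        (show 0 < (-l).toNat by omega),
        show k.toNat = (-l).toNat ↔ k + l = 0 by omega]
      split_ifs
      · module
      · simp
    · simp [JopU_zero, hk.ne']
    · rw [JopU_of_pos b u hk, JopU_of_pos b u hl, if_neg (by omega)]
      simp only [map_smul, LinearMap.smul_apply, pderivN_comm (show 0 < k.toNat by omega)
        (show 0 < l.toNat by omega)]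
      module

lemma exists_JopU_eq_zero (b u : K) (f : Rp K) : ∃ B, ∀ k ≥ B, JopU K b u k f = 0 := by
  obtain ⟨B, hB⟩ := exists_pderivN_eq_zero f
  refine ⟨B + 1, fun k hk => ?_⟩
  rw [JopU_of_pos b u (by omega), LinearMap.smul_apply, hB _ (by omega), smul_zero]

lemma pstar_eq (b u : K) (hb : 1 + b ≠ 0) {i : ℕ} (hi : 1 ≤ i) :
    pstar K i = (1 + b)⁻¹ • JopU K b u i := by
  rw [JopU_of_pos b u (by omega), smul_smul, inv_mul_cancel_left₀ hb, pstar]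
  simp

lemma isCurrentSystem_JopU [TopologicalSpace (Rp K)] [DiscreteTopology (Rp K)] (b u : K)
    (hb : (1 : K) + b ≠ 0) (Mv : ℕ → ℕ → Module.End K (Rp K))
    (hbase1 : ∀ i : ℕ, 1 ≤ i → Mv 1 i = ((1 : K) + b)⁻¹ • JopU K b u ((i : ℤ) - 1))
    (hbase0 : ∀ m : ℕ, 1 ≤ m → Mv m 0 = 0)
    (hfin : ∀ (m i : ℕ) (f : Rp K),
      (Set.Ici 1 ∩ Function.support fun n : ℕ =>
        (JopU K b u ((i : ℤ) - (n : ℤ) - 1)) ((Mv m n) f)).Finite)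
    (hrec : ∀ m : ℕ, 1 ≤ m → ∀ i : ℕ, 1 ≤ i → ∀ f : Rp K,
      (Mv (m + 1) i) f =
        (∑ᶠ n ∈ Set.Ici (1 : ℕ), (JopU K b u ((i : ℤ) - (n : ℤ) - 1)) ((Mv m n) f)) +
          (b * ((i : K) - 1)) • (Mv m (i - 1)) f) :
    IsCurrentSystem (1 + b) b (JopU K b u) (fun n => Mv 2 n.toNat) (fun n => Mv 3 n.toNat) := by
  have hasSum_rec : ∀ m ≥ 1, ∀ i : ℕ, 1 ≤ i → ∀ f,
      HasSum (fun n : ℤ => if 1 ≤ n then JopU K b u (i - n - 1) (Mv m n.toNat f) else 0)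
        (Mv (m + 1) i f - (b * ((i : K) - 1)) • (Mv m (i - 1)) f) := fun m hm i hi f => by
    refine hasSum_indicator_Ici_one_iff.1 (hasSum_indicator_iff_finsum_mem.2 ⟨hfin m i f, ?_⟩)
    rw [hrec m hm i hi f, add_sub_cancel_right]
    rfl
  refine ⟨JopU_comm b u, exists_JopU_eq_zero b u, fun n hn => ?_, fun n hn f => ?_,
    fun n hn => ?_, fun i hi f => ?_⟩
  · simp [Int.toNat_of_nonpos hn, hbase0]
  · lift n to ℕ using by omega
    have hn' : 1 ≤ n := by omega
    convert ((Equiv.addRight (1 : ℤ)).hasSum_iff.2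
      (hasSum_smul_of_discrete (1 + b) (hasSum_rec 1 le_rfl n hn' f))).congr_fun fun c => ?_ using 1
    · rw [smul_sub]
      congr 1
      rcases (by omega : n = 1 ∨ 2 ≤ n) with rfl | hn2
      · simp
      · rw [hbase1 _ (by omega), LinearMap.smul_apply, Nat.cast_sub hn',
          show ((n : ℤ) - (1 : ℕ) - 1) = n - 2 by push_cast; ring]
        rw [smul_comm (1 + b), smul_inv_smul₀ hb]
        module
    · simp only [Function.comp, Equiv.coe_addRight, show 1 ≤ c + 1 ↔ 0 ≤ c by omega]
      split_ifs with hc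
      · rw [hbase1 _ (by omega), LinearMap.smul_apply, map_smul, smul_inv_smul₀ hb, one_smul,
          show (n : ℤ) - (c + 1) - 1 = n - 2 - c by ring,
          show ((c + 1).toNat : ℤ) - 1 = c by omega]
      · simp
  · simp [Int.toNat_of_nonpos hn, hbase0]
  · lift i to ℕ using by omega
    have hi' : 1 ≤ i := by omega
    have e : Mv 3 (i : ℤ).toNat f - ((i : ℤ) - 1) • b • Mv 2 ((i : ℤ) - 1).toNat f
        = Mv (2 + 1) i f - (b * ((i : K) - 1)) • Mv 2 (i - 1) f := by
      simp only [Int.toNat_natCast, show ((i : ℤ) - 1).toNat = i - 1 by omega]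
      module
    rw [e]
    refine (hasSum_rec 2 one_le_two i hi' f).congr_fun fun n => ?_
    split_ifs with hn
    · rfl
    · simp [Int.toNat_of_nonpos (show n ≤ 0 by omega), hbase0]

lemma Dtcoef_swap (b u : K) (i j l m : ℕ) : Dtcoef K b u i j l m = -Dtcoef K b u j i l m := by
  match m with
  | 0 | 1 => exact neg_zero.symm
  | 2 =>
    simp only [Dtcoef, add_comm (j : ℤ)]
    split_ifs
    · module
    · rw [neg_zero]
  | 3 =>
    simp only [Dtcoef, max_comm (j : ℤ), min_comm (j : ℤ), add_comm (j : ℤ)]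
    rw [show ((j : ℤ) - i).sign = -((i : ℤ) - j).sign by rw [← Int.sign_neg, neg_sub]]
    push_cast
    module
  | m + 4 => exact neg_zero.symm

lemma Dtcoef_three_apply (b u : K) {i j : ℕ} (hij : j < i) (l : ℕ) (f : Rp K) :
    Dtcoef K b u i j l 3 f = dCoeff i j l • JopU K b u (i + j - 3 - l) f
      + if (l : ℤ) = i + j - 3 then (((i : ℤ) - j) * (i + j - 3)) • b • f else 0 := by
  have hmax : max (i : ℤ) j = i := max_eq_left (by omega)
  have hmin : min (i : ℤ) j = j := min_eq_right (by omega)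
  have hsign : ((i : ℤ) - j).sign = 1 := Int.sign_eq_one_of_pos (by omega)
  have hd : (((i : K) - j) * (2 * (if (i : ℤ) - 1 ≤ l then (1 : K) else 0)
        + if (i : ℤ) - 1 ≤ l ∧ (l : ℤ) ≤ i + j - 3 then (1 : K) else 0)
      + (((1 : ℤ) : K) * ((2 * (l : ℤ) - 3 * j + 3 : ℤ) : K)) *
        if (j : ℤ) - 1 ≤ l ∧ (l : ℤ) ≤ i - 2 then (1 : K) else 0) = (dCoeff i j l : K) := by
    unfold dCoeff
    by_cases h1 : (i : ℤ) - 1 ≤ l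
    · by_cases h2 : (l : ℤ) ≤ i + j - 3
      · simp only [h1, h2, show ¬(l : ℤ) ≤ i - 2 by omega, and_self, and_false, if_true, if_false]
        push_cast
        ring
      · simp only [h1, h2, show ¬(l : ℤ) ≤ i - 2 by omega, and_false, if_true, if_false]
        push_cast
        ring
    · by_cases h2 : (j : ℤ) - 1 ≤ l
      · simp only [h1, h2, show (l : ℤ) ≤ i - 2 by omega, and_self, false_and, if_true, if_false]
        push_cast
        ring
      · simp only [h1, h2, false_and, if_false]
        push_cast
        ring
  simp only [Dtcoef, hmax, hmin, hsign, hd]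
  split_ifs
  · simp only [LinearMap.add_apply, LinearMap.smul_apply, Module.End.one_apply]
    module
  · simp only [LinearMap.add_apply, LinearMap.smul_apply, LinearMap.zero_apply]
    module

section Discrete

variable [TopologicalSpace (Rp K)] [DiscreteTopology (Rp K)]

lemma hasSum_Dtcoef_two (b u : K) {i j : ℕ} (hi : 1 ≤ i) (hj : 1 ≤ j) (g : ℤ → Rp K) :
    HasSum ((Set.Ici (1 : ℕ)).indicator fun l => Dtcoef K b u i j l 2 (g l))
      (((i : ℤ) - j) • g (i + j - 2)) := by
  have h := hasSum_ite_eq ((i : ℤ) + j - 2) (((i : ℤ) - j) • g (i + j - 2))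
  have e : ∀ l : ℕ, Dtcoef K b u i j l 2 (g l)
      = if (l : ℤ) = i + j - 2 then ((i : ℤ) - j) • g (i + j - 2) else 0 := fun l => by
    simp only [Dtcoef]
    split_ifs with hl
    · rw [hl, LinearMap.smul_apply, Module.End.one_apply]
      module
    · rfl
  simp only [e]
  refine (hasSum_indicator_Ici_one_iff
    (g := fun l => if l = i + j - 2 then ((i : ℤ) - j) • g (i + j - 2) else 0)).2
    (h.congr_fun fun l => ?_)
  by_cases hl : 1 ≤ l
  · rw [if_pos hl]
  · rw [if_neg hl]
    split_ifs with hl'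
    · rw [show (i : ℤ) - j = 0 by omega, zero_smul]
    · rfl

lemma hasSum_Dtcoef_three {b u : K} {i j : ℕ} (hj : 1 ≤ j) (hij : j < i) {g : ℤ → Rp K}
    {a : Rp K} (h : HasSum
      (fun l : ℤ => (if 1 ≤ l then dCoeff i j l else 0) • JopU K b u (i + j - 3 - l) (g l))
      (a - (((i : ℤ) - j) * (i + j - 3)) • b • g (i + j - 3))) :
    HasSum ((Set.Ici (1 : ℕ)).indicator fun l => Dtcoef K b u i j l 3 (g l)) a := by
  have h' := h.add (hasSum_ite_eq ((i : ℤ) + j - 3)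
    ((((i : ℤ) - j) * (i + j - 3)) • b • g (i + j - 3)))
  rw [sub_add_cancel] at h'
  simp only [Dtcoef_three_apply b u hij]
  refine (hasSum_indicator_Ici_one_iff (g := fun l => dCoeff i j l • JopU K b u (i + j - 3 - l) (g l)
      + if l = i + j - 3 then (((i : ℤ) - j) * (i + j - 3)) • b • g l else 0)).2
    (h'.congr_fun fun l => ?_)
  by_cases hl : 1 ≤ l
  · simp only [hl, if_true]
    split_ifs with hl'
    · rw [hl']
    · rfl
  · simp only [hl, if_false, zero_smul, zero_add]
    split_ifs with hl'
    · rw [show (i : ℤ) + j - 3 = 0 by omega]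
      simp
    · rfl

end Discrete

/-- The family `p_l^*`, `M⁽¹⁾_l`, `M⁽²⁾_l = P_l`, `M⁽³⁾_l = W_l`, in terms of the currents. -/
def currentFamily (b u : K) (P W : ℤ → Module.End K (Rp K)) : ℕ → ℤ → Module.End K (Rp K)
  | 0 => fun l => (1 + b)⁻¹ • JopU K b u l
  | 1 => fun l => (1 + b)⁻¹ • JopU K b u (l - 1)
  | 2 => P
  | 3 => W
  | _ => 0

lemma exists_currentFamily_eq (b u : K) (P W : ℤ → Module.End K (Rp K)) {m : ℕ} (hm : m ≤ 1) :
    ∃ ε : ℤ, (ε = -1 ∨ ε = 0) ∧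
      ∀ l f, currentFamily b u P W m l f = (1 + b)⁻¹ • JopU K b u (l + ε) f := by
  interval_cases m
  · exact ⟨0, .inr rfl, fun l f => by rw [add_zero]; rfl⟩
  · exact ⟨-1, .inl rfl, fun l f => rfl⟩

lemma Dtcoef_eq_zero (b u : K) (i j l : ℕ) {m : ℕ} (hm : m ≤ 1) : Dtcoef K b u i j l m = 0 := by
  interval_cases m <;> rfl

section Family

variable [CharZero K] [TopologicalSpace (Rp K)] [DiscreteTopology (Rp K)] {b u : K}
  {P W : ℤ → Module.End K (Rp K)}

lemma hasSum_Dtcoef_currentFamily_of_le (h : IsCurrentSystem (1 + b) b (JopU K b u) P W)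
    (hb : 1 + b ≠ 0) {i j : ℕ} (hj : 1 ≤ j) (hij : j < i) {m m' : ℕ} (hm : m ≤ m') (hm' : m' ≤ 3)
    (f : Rp K) :
    HasSum ((Set.Ici (1 : ℕ)).indicator fun l =>
        Dtcoef K b u i j l m' (currentFamily b u P W m l f)
          + Dtcoef K b u i j l m (currentFamily b u P W m' l f))
      ((⁅currentFamily b u P W m i, currentFamily b u P W m' j⁆
        - ⁅currentFamily b u P W m j, currentFamily b u P W m' i⁆) f) := by
  have hi : 1 ≤ i := by omega
  have hi' : (1 : ℤ) ≤ i := by omega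
  have hj' : (1 : ℤ) ≤ j := by omega
  have hij' : (j : ℤ) < i := by omega
  simp only [Set.indicator_add]
  simp only [LinearMap.sub_apply, Ring.lie_def, Module.End.mul_apply]
  rcases (by omega : m ≤ 1 ∨ 2 ≤ m) with hm1 | hm2
  · obtain ⟨ε, hε, hF⟩ := exists_currentFamily_eq b u P W hm1
    simp only [Dtcoef_eq_zero b u i j _ hm1, LinearMap.zero_apply, Set.indicator_zero, add_zero, hF]
    have hiε : 0 ≤ i + ε := by omega
    have hjε : 0 ≤ j + ε := by omega
    rcases (by omega : m' ≤ 1 ∨ m' = 2 ∨ m' = 3) with hm1' | rfl | rfl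
    · obtain ⟨ε', hε', hF'⟩ := exists_currentFamily_eq b u P W hm1'
      simp only [Dtcoef_eq_zero b u i j _ hm1', LinearMap.zero_apply, hF', map_smul]
      have hcomm : ∀ k l : ℤ, 0 ≤ k → 0 ≤ l → JopU K b u k (JopU K b u l f)
          = JopU K b u l (JopU K b u k f) := fun k l hk hl => by
        rw [JopU_comm, show (if k + l = 0 then k else 0) = 0 by split_ifs <;> omega, zero_smul,
          add_zero]
      rw [hcomm (i + ε) (j + ε') hiε (by omega), hcomm (j + ε) (i + ε') hjε (by omega)]
      simp
    · convert hasSum_Dtcoef_two b u hi hj (fun l => (1 + b)⁻¹ • JopU K b u (l + ε) f) using 1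
      change _ • JopU K b u (i + ε) (P j f) - P j _ - (_ • JopU K b u (j + ε) (P i f) - P i _) = _
      rw [h.J_P_of_nonneg hb hiε hj', h.J_P_of_nonneg hb hjε hi', map_smul, map_smul,
        show (i : ℤ) + ε + j - 2 = i + j - 2 + ε by ring,
        show (j : ℤ) + ε + i - 2 = i + j - 2 + ε by ring]
      module
    · refine hasSum_Dtcoef_three (g := fun l => (1 + b)⁻¹ • JopU K b u (l + ε) f) hj hij ?_
      change HasSum _ (_ • JopU K b u (i + ε) (W j f) - W j _
        - (_ • JopU K b u (j + ε) (W i f) - W i _) - _)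
      refine hasSum_of_eq ((hasSum_smul_of_discrete (1 + b)⁻¹
        (h.hasSum_J_W_sub hb hj' hij' hε f)).congr_fun fun l => ?_) ?_
      · rw [map_smul]
        module
      · simp only [map_smul]
        module
  · rcases (by omega : m = 2 ∧ m' = 2 ∨ m = 2 ∧ m' = 3 ∨ m = 3 ∧ m' = 3) with
      ⟨rfl, rfl⟩ | ⟨rfl, rfl⟩ | ⟨rfl, rfl⟩
    · have h2 := hasSum_Dtcoef_two b u hi hj fun l => P l f
      change HasSum _ (P i (P j f) - P j (P i f) - (P j (P i f) - P i (P j f)))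
      rw [h.P_P hb hi' hj']
      refine hasSum_of_eq (h2.add h2) ?_
      module
    · change HasSum _ (P i (W j f) - W j (P i f) - (P j (W i f) - W i (P j f)))
      have h3 := hasSum_Dtcoef_three hj hij (u := u) (a := (W i (P j f) - P j (W i f))
        - (W j (P i f) - P i (W j f)) - ((i : ℤ) - j) • W (i + j - 2) f)
        (h.hasSum_W_P_sub hb hj' hij' f)
      refine hasSum_of_eq (h3.add (hasSum_Dtcoef_two b u hi hj fun l => W l f)) ?_
      abel
    · change HasSum _ (W i (W j f) - W j (W i f) - (W j (W i f) - W i (W j f)))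
      have h3 := hasSum_Dtcoef_three hj hij (h.hasSum_W_W hb hj' hij' f)
      refine hasSum_of_eq (h3.add h3) ?_
      abel

lemma hasSum_Dtcoef_currentFamily (h : IsCurrentSystem (1 + b) b (JopU K b u) P W)
    (hb : 1 + b ≠ 0) {i j : ℕ} (hi : 1 ≤ i) (hj : 1 ≤ j) {m m' : ℕ} (hm : m ≤ 3) (hm' : m' ≤ 3)
    (f : Rp K) :
    HasSum ((Set.Ici (1 : ℕ)).indicator fun l =>
        Dtcoef K b u i j l m' (currentFamily b u P W m l f)
          + Dtcoef K b u i j l m (currentFamily b u P W m' l f))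
      ((⁅currentFamily b u P W m i, currentFamily b u P W m' j⁆
        - ⁅currentFamily b u P W m j, currentFamily b u P W m' i⁆) f) := by
  wlog hmm : m ≤ m' generalizing m m'
  · refine hasSum_of_eq ((this hm' hm (by omega)).congr_fun fun l => ?_) ?_
    · simp only [add_comm]
    · simp only [LinearMap.sub_apply, Ring.lie_def]
      abel
  rcases lt_trichotomy i j with hij | rfl | hij
  · refine hasSum_of_eq ((hasSum_Dtcoef_currentFamily_of_le h hb hi hij hmm hm' f).neg.congr_fun
      fun l => ?_) ?_
    · simp only [Set.indicator_apply, Dtcoef_swap b u i j, LinearMap.neg_apply]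
      split_ifs <;> module
    · rw [← LinearMap.neg_apply, neg_sub]
  · have hD : ∀ l m, Dtcoef K b u i i l m = 0 := fun l m => by
      have h2 := Dtcoef_swap b u i i l m
      rw [eq_neg_iff_add_eq_zero, ← two_smul K] at h2
      exact (smul_eq_zero.1 h2).resolve_left two_ne_zero
    simp only [hD, LinearMap.zero_apply, add_zero, sub_self, Set.indicator_zero]
    exact hasSum_zero
  · exact hasSum_Dtcoef_currentFamily_of_le h hb hj hij hmm hm' f

end Family

end Polynomials

/--
**Commutation relations for the operators of `b`-deformed bipartite maps with vertices of
degree at most three.**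
Given the operators `M⁽ᵐ⁾_i` determined by `M⁽¹⁾_i = (1+b)⁻¹·J_{i−1}` for `i ≥ 1`,
`M⁽ᵐ⁾₀ = 0` (`m ≥ 1`), and the (locally finite) recursion
`M⁽ᵐ⁺¹⁾_i = Σ_{n≥1} J_{i−n−1} ∘ M⁽ᵐ⁾_n + b(i−1)·M⁽ᵐ⁾_{i−1}`,
one has, for all `i, j ≥ 1` and `1 ≤ m, m' ≤ 3` (all sums over `l ≥ 1` being locally finite):
(a) `[M⁽ᵐ⁾_i, M⁽ᵐ⁾_j] = Σ_{l≥1} D̃_{ij,l}(m) ∘ M⁽ᵐ⁾_l`;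
(b) `[M⁽ᵐ⁾_i, M⁽ᵐ'⁾_j] − [M⁽ᵐ⁾_j, M⁽ᵐ'⁾_i]
     = Σ_{l≥1} (D̃_{ij,l}(m') ∘ M⁽ᵐ⁾_l + D̃_{ij,l}(m) ∘ M⁽ᵐ'⁾_l)`;
(c) `[p_i^*, M⁽ᵐ⁾_j] − [p_j^*, M⁽ᵐ⁾_i] = Σ_{l≥1} D̃_{ij,l}(m) ∘ p_l^*`.
-/
theorem stmt_13 {K : Type} [Field K] [CharZero K] (b u : K) (hb : (1 : K) + b ≠ 0)
    (Mv : ℕ → ℕ → Module.End K (Rp K))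
    (hbase1 : ∀ i : ℕ, 1 ≤ i → Mv 1 i = ((1 : K) + b)⁻¹ • JopU K b u ((i : ℤ) - 1))
    (hbase0 : ∀ m : ℕ, 1 ≤ m → Mv m 0 = 0)
    (hfin : ∀ (m i : ℕ) (f : Rp K),
      (Set.Ici 1 ∩ Function.support fun n : ℕ =>
        (JopU K b u ((i : ℤ) - (n : ℤ) - 1)) ((Mv m n) f)).Finite)
    (hrec : ∀ m : ℕ, 1 ≤ m → ∀ i : ℕ, 1 ≤ i → ∀ f : Rp K,
      (Mv (m + 1) i) f =
        (∑ᶠ n ∈ Set.Ici (1 : ℕ), (JopU K b u ((i : ℤ) - (n : ℤ) - 1)) ((Mv m n) f)) +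
          (b * ((i : K) - 1)) • (Mv m (i - 1)) f) :
    ∀ i j : ℕ, 1 ≤ i → 1 ≤ j →
      (∀ m : ℕ, 1 ≤ m → m ≤ 3 →
        (∀ f : Rp K, ⁅Mv m i, Mv m j⁆ f =
            ∑ᶠ l ∈ Set.Ici (1 : ℕ), (Dtcoef K b u i j l m) ((Mv m l) f)) ∧
        (∀ f : Rp K, (Set.Ici 1 ∩ Function.support fun l : ℕ =>
            (Dtcoef K b u i j l m) ((Mv m l) f)).Finite)) ∧
      (∀ m : ℕ, 1 ≤ m → m ≤ 3 → ∀ m' : ℕ, 1 ≤ m' → m' ≤ 3 →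
        (∀ f : Rp K, (⁅Mv m i, Mv m' j⁆ - ⁅Mv m j, Mv m' i⁆) f =
            ∑ᶠ l ∈ Set.Ici (1 : ℕ),
              ((Dtcoef K b u i j l m') ((Mv m l) f) + (Dtcoef K b u i j l m) ((Mv m' l) f))) ∧
        (∀ f : Rp K, (Set.Ici 1 ∩ Function.support fun l : ℕ =>
            (Dtcoef K b u i j l m') ((Mv m l) f) +
              (Dtcoef K b u i j l m) ((Mv m' l) f)).Finite)) ∧
      (∀ m : ℕ, 1 ≤ m → m ≤ 3 →
        (∀ f : Rp K, (⁅pstar K i, Mv m j⁆ - ⁅pstar K j, Mv m i⁆) f =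
            ∑ᶠ l ∈ Set.Ici (1 : ℕ), (Dtcoef K b u i j l m) ((pstar K l) f)) ∧
        (∀ f : Rp K, (Set.Ici 1 ∩ Function.support fun l : ℕ =>
            (Dtcoef K b u i j l m) ((pstar K l) f)).Finite)) := by
  let _ : TopologicalSpace (Rp K) := ⊥
  have : DiscreteTopology (Rp K) := ⟨rfl⟩
  have h := isCurrentSystem_JopU b u hb Mv hbase1 hbase0 hfin hrec
  have hMv : ∀ m : ℕ, 1 ≤ m → m ≤ 3 → ∀ l : ℕ, 1 ≤ l →
      currentFamily b u (fun n => Mv 2 n.toNat) (fun n => Mv 3 n.toNat) m l = Mv m l := by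
    intro m hm hm3 l hl
    interval_cases m
    · exact (hbase1 l hl).symm
    · rfl
    · rfl
  have hpstar : ∀ l : ℕ, 1 ≤ l →
      currentFamily b u (fun n => Mv 2 n.toNat) (fun n => Mv 3 n.toNat) 0 l = pstar K l :=
    fun l hl => (pstar_eq b u hb hl).symm
  intro i j hi hj
  refine ⟨fun m hm hm3 => ?_, fun m hm hm3 m' hm' hm3' => ?_, fun m hm hm3 => ?_⟩
  · rw [← forall_and]
    intro f
    have hS := hasSum_Dtcoef_currentFamily h hb hi hj hm3 hm3 f
    rw [hMv m hm hm3 i hi, hMv m hm hm3 j hj] at hS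
    refine (hasSum_indicator_iff_finsum_mem.1 (hasSum_of_eq ((hasSum_smul_of_discrete (2⁻¹ : K)
      hS).congr_fun fun l => ?_) ?_)).symm
    · simp only [Set.indicator_apply, Set.mem_Ici]
      split_ifs with hl
      · rw [hMv m hm hm3 l hl, ← two_smul K, inv_smul_smul₀ two_ne_zero]
      · rw [smul_zero]
    · rw [inv_smul_eq_iff₀ two_ne_zero]
      simp only [LinearMap.sub_apply, Ring.lie_def]
      module
  · rw [← forall_and]
    intro f
    have hS := hasSum_Dtcoef_currentFamily h hb hi hj hm3 hm3' f
    rw [hMv m hm hm3 i hi, hMv m hm hm3 j hj, hMv m' hm' hm3' i hi, hMv m' hm' hm3' j hj] at hS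
    refine (hasSum_indicator_iff_finsum_mem.1 (hS.congr_fun fun l => ?_)).symm
    simp only [Set.indicator_apply, Set.mem_Ici]
    split_ifs with hl
    · rw [hMv m hm hm3 l hl, hMv m' hm' hm3' l hl]
    · rfl
  · rw [← forall_and]
    intro f
    have hS := hasSum_Dtcoef_currentFamily h hb hi hj (Nat.zero_le 3) hm3 f
    rw [hMv m hm hm3 i hi, hMv m hm hm3 j hj, hpstar i hi, hpstar j hj] at hS
    refine (hasSum_indicator_iff_finsum_mem.1 (hS.congr_fun fun l => ?_)).symm
    simp only [Set.indicator_apply, Set.mem_Ici]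
    split_ifs with hl
    · rw [hpstar l hl, Dtcoef_eq_zero b u i j l zero_le_one, LinearMap.zero_apply, add_zero]
    · rfl
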